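/- Let 𝒫 and 𝒬 be convex sets of probability measures on (Ω,ℱ) with 𝒬 ≪≪ 𝒫, and fix ε, δ > 0. Suppose that for each A ∈ ℱ such that there exists P ∈ 𝒫 with P(A) ≥ ε, there exists Q ∈ 𝒬 with Q(A) ≥ δ. Then for every fixed P ∈ 𝒫: inf over h ∈ D^{ε,P} of sup over Q ∈ 𝒬 of E_Q[h] is at least εδ. -/

import Mathlib

open MeasureTheory Filter Topology
open scoped ENNReal NNReal

namespace RobustHS


variable {Ω : Type*} [MeasurableSpace Ω]

/-- A property `p` holds `Ps`-quasi-surely if it holds outside of a measurable set which is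
null for every measure in `Ps` (equivalently, outside of a polar set). -/
def QS (Ps : Set (Measure Ω)) (p : Ω → Prop) : Prop :=
  ∃ N : Set Ω, MeasurableSet N ∧ (∀ P ∈ Ps, P N = 0) ∧ ∀ ω, ω ∉ N → p ω

/-- Convexity of a set of measures. -/
def MConvex (Ps : Set (Measure Ω)) : Prop :=
  ∀ P ∈ Ps, ∀ P' ∈ Ps, ∀ t : ℝ≥0∞, t ≤ 1 → t • P + (1 - t) • P' ∈ Ps

/-- `Qs ≪≪ Ps` : every `Q ∈ Qs` is absolutely continuous with respect to some `P ∈ Ps`. -/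
def DominatedBy (Qs Ps : Set (Measure Ω)) : Prop := ∀ Q ∈ Qs, ∃ P ∈ Ps, Q ≪ P

/-- The underlying set of the space `E`: all finite signed measures which are absolutely
continuous with respect to at least one `P ∈ Ps`. -/
def Edom (Ps : Set (Measure Ω)) : Set (SignedMeasure Ω) :=
  {μ | ∃ P ∈ Ps, μ ≪ᵥ P.toENNRealVectorMeasure}

/-- The total variation norm of a finite signed measure. -/
noncomputable def tvnorm (μ : SignedMeasure Ω) : ℝ := (μ.totalVariation Set.univ).toReal

/-- A nonempty convex set of probability measures on `Ω`. -/
structure ConvexProbFamily (Ω : Type*) [MeasurableSpace Ω] where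
  sets : Set (Measure Ω)
  nonempty : sets.Nonempty
  isProb : ∀ P ∈ sets, IsProbabilityMeasure P
  convex : MConvex sets

/-- The space `E` as a submodule of the signed measures on `Ω`. -/
noncomputable def Esub (C : ConvexProbFamily Ω) : Submodule ℝ (SignedMeasure Ω) where
  carrier := Edom C.sets
  zero_mem' := by
    obtain ⟨P, hP⟩ := C.nonempty
    exact ⟨P, hP, fun s _ => rfl⟩
  add_mem' := by
    rintro μ₁ μ₂ ⟨P₁, hP₁, hac₁⟩ ⟨P₂, hP₂, hac₂⟩
    refine ⟨(2⁻¹ : ℝ≥0∞) • P₁ + (1 - 2⁻¹ : ℝ≥0∞) • P₂,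
      C.convex P₁ hP₁ P₂ hP₂ 2⁻¹ (by simp [ENNReal.inv_le_one]), ?_⟩
    intro s hs
    rw [VectorMeasure.add_apply]
    by_cases hm : MeasurableSet s
    · rw [Measure.toENNRealVectorMeasure_apply_measurable hm, Measure.add_apply,
        Measure.smul_apply, Measure.smul_apply, smul_eq_mul, smul_eq_mul,
        add_eq_zero, mul_eq_zero, mul_eq_zero] at hs
      have h1 : P₁ s = 0 := by
        rcases hs.1 with h | h
        · exact absurd h (by simp)
        · exact h
      have h2 : P₂ s = 0 := by
        rcases hs.2 with h | h
        · exact absurd h (by simp [ENNReal.one_sub_inv_two])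
        · exact h
      rw [hac₁ (by rw [Measure.toENNRealVectorMeasure_apply_measurable hm]; exact h1),
        hac₂ (by rw [Measure.toENNRealVectorMeasure_apply_measurable hm]; exact h2), add_zero]
    · rw [VectorMeasure.not_measurable _ hm, VectorMeasure.not_measurable _ hm, add_zero]
  smul_mem' := by
    rintro c μ ⟨P, hP, hac⟩
    exact ⟨P, hP, fun s hs => by rw [VectorMeasure.smul_apply, hac hs, smul_zero]⟩



theorem exists_hahn (s : SignedMeasure Ω) :
    ∃ i : Set Ω, MeasurableSet i ∧ (0 ≤[i] s) ∧ (s ≤[iᶜ] 0) ∧ tvnorm s = s i - s iᶜ := by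
  obtain ⟨i, hi₁, hi₂, hi₃, hpos, hneg⟩ := s.toJordanDecomposition_spec
  refine ⟨i, hi₁, hi₂, hi₃, ?_⟩
  rw [tvnorm, SignedMeasure.totalVariation, Measure.add_apply, hpos, hneg,
    SignedMeasure.toMeasureOfZeroLE_apply _ hi₂ hi₁ MeasurableSet.univ,
    SignedMeasure.toMeasureOfLEZero_apply _ hi₃ hi₁.compl MeasurableSet.univ]
  rw [← ENNReal.coe_add, ENNReal.coe_toReal, NNReal.coe_add, NNReal.coe_mk, NNReal.coe_mk]
  rw [Set.inter_univ, Set.inter_univ]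
  ring

theorem apply_sub_compl_le (s : SignedMeasure Ω) {A : Set Ω} (hA : MeasurableSet A) :
    s A - s Aᶜ ≤ tvnorm s := by
  obtain ⟨i, hi₁, hi₂, hi₃, heq⟩ := exists_hahn s
  rw [heq]
  have hAi : s A = s (A ∩ i) + s (A ∩ iᶜ) := by
    conv_lhs => rw [← Set.inter_union_compl A i]
    exact s.of_union (Set.disjoint_of_subset Set.inter_subset_right Set.inter_subset_right
      disjoint_compl_right) (hA.inter hi₁) (hA.inter hi₁.compl)
  have hiA : s i = s (A ∩ i) + s (Aᶜ ∩ i) := by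
    conv_lhs => rw [← Set.inter_union_compl i A, Set.inter_comm i A, Set.inter_comm i Aᶜ]
    exact s.of_union (Set.disjoint_of_subset Set.inter_subset_left Set.inter_subset_left
      disjoint_compl_right) (hA.inter hi₁) (hA.compl.inter hi₁)
  have hAci : s Aᶜ = s (Aᶜ ∩ i) + s (Aᶜ ∩ iᶜ) := by
    conv_lhs => rw [← Set.inter_union_compl Aᶜ i]
    exact s.of_union (Set.disjoint_of_subset Set.inter_subset_right Set.inter_subset_right
      disjoint_compl_right) (hA.compl.inter hi₁) (hA.compl.inter hi₁.compl)
  have hic : s iᶜ = s (Aᶜ ∩ iᶜ) + s (A ∩ iᶜ) := by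
    conv_lhs => rw [← Set.inter_union_compl iᶜ Aᶜ, Set.inter_comm iᶜ Aᶜ, Set.inter_comm iᶜ Aᶜᶜ,
      compl_compl]
    exact s.of_union (Set.disjoint_of_subset Set.inter_subset_left Set.inter_subset_left
      disjoint_compl_left) (hA.compl.inter hi₁.compl)
      (hA.inter hi₁.compl)
  have h1 : s (A ∩ iᶜ) ≤ 0 :=
    s.nonpos_of_restrict_le_zero (s.restrict_le_zero_subset hi₁.compl Set.inter_subset_right hi₃)
  have h2 : 0 ≤ s (Aᶜ ∩ i) :=
    s.nonneg_of_zero_le_restrict (s.zero_le_restrict_subset hi₁ Set.inter_subset_right hi₂)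
  have h3 : s (Aᶜ ∩ iᶜ) ≤ 0 :=
    s.nonpos_of_restrict_le_zero (s.restrict_le_zero_subset hi₁.compl Set.inter_subset_right hi₃)
  linarith

theorem tvnorm_add_le (s t : SignedMeasure Ω) : tvnorm (s + t) ≤ tvnorm s + tvnorm t := by
  obtain ⟨i, hi₁, hi₂, hi₃, heq⟩ := exists_hahn (s + t)
  rw [heq, VectorMeasure.add_apply, VectorMeasure.add_apply]
  have h1 := apply_sub_compl_le s hi₁
  have h2 := apply_sub_compl_le t hi₁
  linarith

theorem tvnorm_eq_zero {s : SignedMeasure Ω} (h : tvnorm s = 0) : s = 0 := by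
  have hfin : s.totalVariation Set.univ ≠ ⊤ := by
    have : IsFiniteMeasure s.totalVariation := by
      rw [SignedMeasure.totalVariation]; infer_instance
    exact measure_ne_top _ _
  have hzero : s.totalVariation Set.univ = 0 := by
    rwa [tvnorm, ENNReal.toReal_eq_zero_iff, or_iff_left hfin] at h
  ext A hA
  rw [VectorMeasure.zero_apply]
  exact s.null_of_totalVariation_zero (measure_mono_null (Set.subset_univ A) hzero)

theorem tvnorm_smul (c : ℝ) (s : SignedMeasure Ω) : tvnorm (c • s) = |c| * tvnorm s := by
  rw [tvnorm, tvnorm, SignedMeasure.totalVariation, SignedMeasure.totalVariation,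
    s.toJordanDecomposition_smul_real c, JordanDecomposition.real_smul_def]
  by_cases hc : 0 ≤ c
  · rw [if_pos hc, JordanDecomposition.smul_posPart, JordanDecomposition.smul_negPart]
    rw [Measure.add_apply, Measure.add_apply, Measure.smul_apply, Measure.smul_apply,
      ← smul_add, ENNReal.toReal_smul]
    rw [abs_of_nonneg hc, NNReal.smul_def, smul_eq_mul, Real.coe_toNNReal c hc]
  · rw [if_neg hc, JordanDecomposition.neg_posPart, JordanDecomposition.neg_negPart,
      JordanDecomposition.smul_posPart, JordanDecomposition.smul_negPart]
    rw [Measure.add_apply, Measure.add_apply, Measure.smul_apply, Measure.smul_apply,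
      ← smul_add, ENNReal.toReal_smul, add_comm]
    have : |c| = -c := abs_of_neg (not_le.1 hc)
    rw [this, NNReal.smul_def, smul_eq_mul,
      Real.coe_toNNReal _ (by linarith [not_le.1 hc] : (0:ℝ) ≤ -c), neg_mul]


theorem tvnorm_neg (s : SignedMeasure Ω) : tvnorm (-s) = tvnorm s := by
  rw [tvnorm, tvnorm, SignedMeasure.totalVariation_neg]

noncomputable instance instNormedE (C : ConvexProbFamily Ω) :
    NormedAddCommGroup (Esub C) :=
  AddGroupNorm.toNormedAddCommGroup
    { toFun := fun μ => tvnorm (μ : SignedMeasure Ω)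
      map_zero' := by simp [tvnorm, SignedMeasure.totalVariation_zero]
      add_le' := fun μ ν => tvnorm_add_le μ.1 ν.1
      neg' := fun μ => tvnorm_neg μ.1
      eq_zero_of_map_eq_zero' := fun μ h => Subtype.ext (tvnorm_eq_zero h) }

noncomputable instance instNormedSpaceE (C : ConvexProbFamily Ω) :
    NormedSpace ℝ (Esub C) where
  norm_smul_le c μ := by
    have h : tvnorm ((c • μ : Esub C) : SignedMeasure Ω) = |c| * tvnorm (μ : SignedMeasure Ω) :=
      tvnorm_smul c μ.1
    calc ‖c • μ‖ = |c| * tvnorm (μ : SignedMeasure Ω) := h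
    _ ≤ ‖c‖ * ‖μ‖ := by rw [Real.norm_eq_abs]; exact le_of_eq rfl

noncomputable def sintegral (h : Ω → ℝ) (μ : SignedMeasure Ω) : ℝ :=
  ∫ ω, h ω ∂μ.toJordanDecomposition.posPart - ∫ ω, h ω ∂μ.toJordanDecomposition.negPart

def MemLinf (Ps : Set (Measure Ω)) (h : Ω → ℝ) : Prop :=
  Measurable h ∧ ∃ M : ℝ, QS Ps fun ω => |h ω| ≤ M

def Represents (C : ConvexProbFamily Ω) (y : Esub C →L[ℝ] ℝ) (h : Ω → ℝ) : Prop :=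
  ∀ μ : Esub C, y μ = sintegral h (μ : SignedMeasure Ω)

def DualSurj (C : ConvexProbFamily Ω) : Prop :=
  ∀ y : Esub C →L[ℝ] ℝ, ∃ h : Ω → ℝ, MemLinf C.sets h ∧ Represents C y h

noncomputable def linfNorm (Ps : Set (Measure Ω)) (h : Ω → ℝ) : ℝ :=
  sInf {M : ℝ | 0 ≤ M ∧ QS Ps fun ω => |h ω| ≤ M}

def LinfRep (C : ConvexProbFamily Ω) : Type _ := {f : Ω → ℝ // MemLinf C.sets f}

instance linfSetoid (C : ConvexProbFamily Ω) : Setoid (LinfRep C) where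
  r f g := QS C.sets fun ω => f.1 ω = g.1 ω
  iseqv := by
    refine ⟨fun f => ⟨∅, MeasurableSet.empty, fun P _ => measure_empty, fun ω _ => rfl⟩,
      fun {f g} hfg => ?_, fun {f g k} h₁ h₂ => ?_⟩
    · obtain ⟨N, hN, hnull, h⟩ := hfg
      exact ⟨N, hN, hnull, fun ω hω => (h ω hω).symm⟩
    · obtain ⟨N₁, hN₁, hnull₁, hh₁⟩ := h₁
      obtain ⟨N₂, hN₂, hnull₂, hh₂⟩ := h₂
      exact ⟨N₁ ∪ N₂, hN₁.union hN₂,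
        fun P hP => measure_union_null (hnull₁ P hP) (hnull₂ P hP),
        fun ω hω => (hh₁ ω fun hmem => hω (Set.mem_union_left _ hmem)).trans
          (hh₂ ω fun hmem => hω (Set.mem_union_right _ hmem))⟩

def Linf (C : ConvexProbFamily Ω) : Type _ := Quotient (linfSetoid C)

theorem sintegral_congr (C : ConvexProbFamily Ω) {f g : Ω → ℝ}
    (hfg : QS C.sets fun ω => f ω = g ω) {μ : SignedMeasure Ω} (hμ : μ ∈ Edom C.sets) :
    sintegral f μ = sintegral g μ := by
  obtain ⟨N, hN, hnull, heq⟩ := hfg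
  obtain ⟨P, hP, hac⟩ := hμ
  have htv : μ.totalVariation ≪ P := by
    have := (SignedMeasure.absolutelyContinuous_ennreal_iff μ P.toENNRealVectorMeasure).mp hac
    rwa [VectorMeasure.ennrealToMeasure_toENNRealVectorMeasure] at this
  have htvN : μ.totalVariation N = 0 := htv (hnull P hP)
  rw [SignedMeasure.totalVariation, Measure.add_apply, add_eq_zero] at htvN
  have hsub : {ω | ¬ f ω = g ω} ⊆ N := fun ω hω => by
    by_contra hN'
    exact hω (heq ω hN')
  have h1 : f =ᵐ[μ.toJordanDecomposition.posPart] g :=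
    ae_iff.mpr (measure_mono_null hsub htvN.1)
  have h2 : f =ᵐ[μ.toJordanDecomposition.negPart] g :=
    ae_iff.mpr (measure_mono_null hsub htvN.2)
  rw [sintegral, sintegral, integral_congr_ae h1, integral_congr_ae h2]

noncomputable def pairing (C : ConvexProbFamily Ω) (μ : Esub C) : Linf C → ℝ :=
  Quotient.lift (fun f : LinfRep C => sintegral f.1 (μ : SignedMeasure Ω))
    (fun _ _ hfg => sintegral_congr C hfg μ.2)

noncomputable instance instTopLinf (C : ConvexProbFamily Ω) : TopologicalSpace (Linf C) :=
  ⨅ μ : Esub C, TopologicalSpace.induced (pairing C μ) inferInstance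



/-- The gain of the one-period portfolio with strategy `H`: `H · (S₁ - S₀)`. -/
def gain {d : ℕ} (H : Fin d → ℝ) (S0 : Fin d → ℝ) (S1 : Ω → Fin d → ℝ) (ω : Ω) : ℝ :=
  ∑ i, H i * (S1 ω i - S0 i)

/-- The robust no-arbitrage condition `NA(𝒫)` of Bouchard-Nutz (one-period case). -/
def NAcond (Ps : Set (Measure Ω)) {d : ℕ} (S0 : Fin d → ℝ) (S1 : Ω → Fin d → ℝ) : Prop :=
  ∀ H : Fin d → ℝ, QS Ps (fun ω => 0 ≤ gain H S0 S1 ω) → QS Ps (fun ω => gain H S0 S1 ω = 0)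

/-- The expectation `E_Q[f] = E_Q[f⁺] - E_Q[f⁻]`, valued in `EReal`, with the convention
`∞ - ∞ = -∞` (which holds for `EReal` subtraction). -/
noncomputable def convExp (Q : Measure Ω) (f : Ω → ℝ) : EReal :=
  ((∫⁻ ω, ENNReal.ofReal (f ω) ∂Q : ℝ≥0∞) : EReal) -
    ((∫⁻ ω, ENNReal.ofReal (-f ω) ∂Q : ℝ≥0∞) : EReal)

/-- The set `𝒬` of martingale measures dominated by some measure of `Ps`. -/
def MartSet (Ps : Set (Measure Ω)) {d : ℕ} (S0 : Fin d → ℝ) (S1 : Ω → Fin d → ℝ) :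
    Set (Measure Ω) :=
  {Q | IsProbabilityMeasure Q ∧ (∃ P ∈ Ps, Q ≪ P) ∧
    ∀ i : Fin d, convExp Q (fun ω => S1 ω i - S0 i) = 0}

section LargeMarket

variable {Ωs : ℕ → Type*} [∀ n, MeasurableSpace (Ωs n)]

/-- A robust large financial market: a sequence of one-period robust markets. -/
structure LargeMarket (Ωs : ℕ → Type*) [∀ n, MeasurableSpace (Ωs n)] where
  d : ℕ → ℕ
  S0 : ∀ n, Fin (d n) → ℝ
  S1 : ∀ n, Ωs n → Fin (d n) → ℝ
  meas_S1 : ∀ n i, Measurable fun ω => S1 n ω i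

/-- Asymptotic arbitrage of the first kind for the sequence of uncertainty sets `Ps`. -/
def AA1 (M : LargeMarket Ωs) (Ps : ∀ n, Set (Measure (Ωs n))) : Prop :=
  ∃ nk : ℕ → ℕ, StrictMono nk ∧
    ∃ H : ∀ k, Fin (M.d (nk k)) → ℝ, ∃ c : ℕ → ℝ,
      (∀ k, 0 < c k) ∧ Tendsto c atTop (nhds 0) ∧
      (∀ k, QS (Ps (nk k)) fun ω => -(c k) ≤ gain (H k) (M.S0 (nk k)) (M.S1 (nk k)) ω) ∧
      ∃ α : ℝ, 0 < α ∧ ∃ Pk : ∀ k, Measure (Ωs (nk k)),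
        (∀ k, Pk k ∈ Ps (nk k)) ∧
        ∀ k, ENNReal.ofReal α ≤ Pk k {ω | α ≤ gain (H k) (M.S0 (nk k)) (M.S1 (nk k)) ω}

/-- No asymptotic arbitrage of the first kind. -/
def NAA1 (M : LargeMarket Ωs) (Ps : ∀ n, Set (Measure (Ωs n))) : Prop := ¬ AA1 M Ps

/-- Asymptotic arbitrage of the second kind. -/
def AA2 (M : LargeMarket Ωs) (Ps : ∀ n, Set (Measure (Ωs n))) : Prop :=
  ∃ nk : ℕ → ℕ, StrictMono nk ∧
    ∃ H : ∀ k, Fin (M.d (nk k)) → ℝ,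
      (∀ k, QS (Ps (nk k)) fun ω => -1 ≤ gain (H k) (M.S0 (nk k)) (M.S1 (nk k)) ω) ∧
      ∃ α : ℝ, 0 < α ∧ ∃ Pk : ∀ k, Measure (Ωs (nk k)),
        (∀ k, Pk k ∈ Ps (nk k)) ∧
        Tendsto (fun k => Pk k {ω | α ≤ gain (H k) (M.S0 (nk k)) (M.S1 (nk k)) ω})
          atTop (nhds 1)

/-- No asymptotic arbitrage of the second kind. -/
def NAA2 (M : LargeMarket Ωs) (Ps : ∀ n, Set (Measure (Ωs n))) : Prop := ¬ AA2 M Ps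

/-- `(Pₙ)` is contiguous with respect to `(Qₙ)`. -/
def Contiguous (P Q : ∀ n, Measure (Ωs n)) : Prop :=
  ∀ A : ∀ n, Set (Ωs n), (∀ n, MeasurableSet (A n)) →
    Tendsto (fun n => Q n (A n)) atTop (nhds 0) → Tendsto (fun n => P n (A n)) atTop (nhds 0)

/-- The sequence of sets `R n` of probability measures is weakly contiguous
with respect to `(Pₙ)`. -/
def WeaklyContiguous (R : ∀ n, Set (Measure (Ωs n))) (P : ∀ n, Measure (Ωs n)) : Prop :=
  ∀ ε : ℝ, 0 < ε → ∃ δ : ℝ, 0 < δ ∧ ∃ Q : ∀ n, Measure (Ωs n), (∀ n, Q n ∈ R n) ∧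
    ∀ n, ∀ A : Set (Ωs n), MeasurableSet A →
      P n A < ENNReal.ofReal δ → Q n A < ENNReal.ofReal ε

end LargeMarket



/-- If `P` assigns a function with values in `[0, 1]` the expectation at least `2 * ε`, then the
set where this function is at least `ε` has `P`-mass at least `ε`. -/
theorem ofReal_le_measure_setOf_le {Ω : Type*} [MeasurableSpace Ω] {P : Measure Ω}
    [IsProbabilityMeasure P] {h : Ω → ℝ} (hm : Measurable h) (hint : Integrable h P)
    (h1 : ∀ᵐ ω ∂P, h ω ≤ 1) {ε : ℝ} (hε : 0 ≤ ε) (hle : 2 * ε ≤ ∫ ω, h ω ∂P) :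
    ENNReal.ofReal ε ≤ P {ω | ε ≤ h ω} := by
  have hA : MeasurableSet {ω | ε ≤ h ω} := measurableSet_le measurable_const hm
  have hbound : ∫ ω, h ω ∂P ≤ ∫ ω, ({ω | ε ≤ h ω}.indicator (fun _ => (1 : ℝ)) ω + ε) ∂P := by
    refine integral_mono_ae hint
      (((integrable_const 1).indicator hA).add (integrable_const ε)) ?_
    filter_upwards [h1] with ω hω
    by_cases hmem : ε ≤ h ω
    · simp only [Set.indicator, Set.mem_ofPred_eq, hmem, if_true]
      linarith
    · simp only [Set.indicator, Set.mem_ofPred_eq, hmem, if_false]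
      linarith
  rw [integral_add ((integrable_const 1).indicator hA) (integrable_const ε),
    integral_indicator_const _ hA, integral_const] at hbound
  simp only [probReal_univ, smul_eq_mul, mul_one, one_mul] at hbound
  rw [← ofReal_measureReal (measure_ne_top P _)]
  exact ENNReal.ofReal_le_ofReal (by linarith)

/-- A quasi-sure property holds almost surely under every dominated measure. -/
theorem QS.ae {Ω : Type*} [MeasurableSpace Ω] {Ps : Set (Measure Ω)} {p : Ω → Prop}
    (hp : QS Ps p) {P Q : Measure Ω} (hP : P ∈ Ps) (hQ : Q ≪ P) : ∀ᵐ ω ∂Q, p ω := by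
  obtain ⟨N, -, hnull, hN⟩ := hp
  refine ae_iff.mpr (measure_mono_null (fun ω hω => ?_) (hQ (hnull P hP)))
  by_contra hmem
  exact hω (hN ω hmem)

/-- **Primal basic lemma.**  Under the ε-δ Halmos-Savage hypothesis,
`inf_{h ∈ D^{ε,P}} sup_{Q ∈ 𝒬} E_Q[h] ≥ εδ`; i.e. for every `h ∈ D^{ε,P}` the supremum
over `Q ∈ 𝒬` of `E_Q[h]` is at least `εδ`. -/
theorem basic_lemma_primal {Ω : Type*} [MeasurableSpace Ω] (C : ConvexProbFamily Ω)
    (Qs : Set (Measure Ω)) (hQprob : ∀ Q ∈ Qs, IsProbabilityMeasure Q)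
    (hQconv : MConvex Qs) (hdom : DominatedBy Qs C.sets)
    (ε δ : ℝ) (hε : 0 < ε) (hδ : 0 < δ)
    (hHS : ∀ A : Set Ω, MeasurableSet A → (∃ P ∈ C.sets, ENNReal.ofReal ε ≤ P A) →
      ∃ Q ∈ Qs, ENNReal.ofReal δ ≤ Q A)
    (P : Measure Ω) (hP : P ∈ C.sets) :
    ∀ h : Ω → ℝ, MemLinf C.sets h → QS C.sets (fun ω => 0 ≤ h ω ∧ h ω ≤ 1) →
      2 * ε ≤ ∫ ω, h ω ∂P →
      ε * δ ≤ sSup {x : ℝ | ∃ Q ∈ Qs, x = ∫ ω, h ω ∂Q} := by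
  intro h hmem hbd hle
  have hmeas : Measurable h := hmem.1
  have hint : ∀ (Q : Measure Ω) [IsProbabilityMeasure Q],
      (∀ᵐ ω ∂Q, 0 ≤ h ω ∧ h ω ≤ 1) → Integrable h Q := by
    intro Q _ hQ
    refine Integrable.of_bound hmeas.aestronglyMeasurable 1 ?_
    filter_upwards [hQ] with ω hω
    rw [Real.norm_eq_abs, abs_of_nonneg hω.1]
    exact hω.2
  have hQbd : ∀ Q ∈ Qs, ∀ᵐ ω ∂Q, 0 ≤ h ω ∧ h ω ≤ 1 := fun Q hQ => by
    obtain ⟨P', hP', hac⟩ := hdom Q hQ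
    exact hbd.ae hP' hac
  have hPprob := C.isProb P hP
  have hPbd := hbd.ae hP Measure.AbsolutelyContinuous.rfl
  obtain ⟨Q, hQ, hQA⟩ := hHS {ω | ε ≤ h ω} (measurableSet_le measurable_const hmeas)
    ⟨P, hP, ofReal_le_measure_setOf_le hmeas (hint P hPbd) (hPbd.mono fun _ hω => hω.2)
      hε.le hle⟩
  have hQprob' := hQprob Q hQ
  have hbdd : BddAbove {x : ℝ | ∃ Q ∈ Qs, x = ∫ ω, h ω ∂Q} := by
    refine ⟨1, ?_⟩
    rintro x ⟨Q, hQ, rfl⟩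
    have hQprob' := hQprob Q hQ
    calc ∫ ω, h ω ∂Q ≤ ∫ _, (1 : ℝ) ∂Q :=
          integral_mono_ae (hint Q (hQbd Q hQ)) (integrable_const 1)
            ((hQbd Q hQ).mono fun _ hω => hω.2)
      _ = 1 := by simp
  calc ε * δ ≤ ε * Q.real {ω | ε ≤ h ω} := by
        gcongr
        exact (ENNReal.ofReal_le_iff_le_toReal (measure_ne_top Q _)).mp hQA
    _ ≤ ∫ ω, h ω ∂Q :=
        mul_meas_ge_le_integral_of_nonneg ((hQbd Q hQ).mono fun _ hω => hω.1)
          (hint Q (hQbd Q hQ)) ε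
    _ ≤ _ := le_csSup hbdd ⟨Q, hQ, rfl⟩

end RobustHS
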